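/- arXiv:1812.10364 — 7 statements merged into one kernel-verified Lean document; each statement's English description precedes it below -/
import Mathlib

section
/- Let I ⊆ ℝ be an open interval, A(t) = A₀ + t·B a d×d real matrix invertible for all t ∈ I, v(t) = v₀ + t·w ∈ ℝ^d, χ(ξ, t) = A(t)ξ + v(t), J(t) = det A(t), and ω(ξ, t) = ∂_t χ(ξ, t) = Bξ + w. Let u : ℝ^d × I → ℝ be continuously differentiable and set u*(ξ, t) = u(χ(ξ, t), t). Then for all ξ ∈ ℝ^d and t ∈ I: J(t)·(∂_t u)(χ(ξ, t), t) = ∂_t [J(t) u*(ξ, t)] − J(t) · div_ξ( ξ' ↦ A(t)⁻¹ ( ω(ξ', t) · u*(ξ', t) ) )(ξ), where div_ξ denotes the trace of the Fréchet derivative with respect to ξ. -/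
open Matrix

/-- The Jacobi formula for the determinant along an affine path of matrices. -/
lemma Matrix.hasDerivAt_det_add_smul {𝕜 n : Type*} [NontriviallyNormedField 𝕜] [Fintype n]
    [DecidableEq n] (A B : Matrix n n 𝕜) (t : 𝕜) (h : IsUnit (A + t • B).det) :
    HasDerivAt (fun s => (A + s • B).det)
      ((A + t • B).det * ((A + t • B)⁻¹ * B).trace) t := by
  set M := A + t • B with hM
  set p := det (1 + (Polynomial.X : Polynomial 𝕜) • (M⁻¹ * B).map Polynomial.C) with hp
  have key : (fun s => (A + s • B).det) = fun s => M.det * p.eval (s - t) := by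
    funext s
    have h1 : A + s • B = M * (1 + (s - t) • (M⁻¹ * B)) := by
      rw [mul_add, mul_smul_comm, ← mul_assoc, Matrix.mul_nonsing_inv _ h, one_mul, mul_one,
        hM, sub_smul]
      abel
    have h2 : p.eval (s - t) = (1 + (s - t) • (M⁻¹ * B)).det := by
      rw [hp]
      generalize M⁻¹ * B = N
      simp [eval_det, ← smul_eq_mul_diagonal]
    rw [h1, det_mul, h2]
  rw [key, ← derivative_det_one_add_X_smul, ← hp, ← sub_self t]
  exact ((p.hasDerivAt (t - t)).comp_sub_const t t).const_mul _

/-- The velocity at time `t` of the affine motion `s ↦ A(s) ξ + v(s)`. -/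
lemma Matrix.hasDerivAt_add_smul_mulVec_add {𝕜 m n : Type*} [NontriviallyNormedField 𝕜]
    [Fintype m] [Fintype n] (A B : Matrix m n 𝕜) (v w : m → 𝕜) (x : n → 𝕜) (t : 𝕜) :
    HasDerivAt (fun s : 𝕜 => (A + s • B) *ᵥ x + (v + s • w)) (B *ᵥ x + w) t := by
  simp only [add_mulVec, smul_mulVec]
  have hsmul (y : m → 𝕜) : HasDerivAt (fun s : 𝕜 => s • y) y t := by
    simpa using (hasDerivAt_id t).smul_const y
  exact ((hsmul _).const_add _).add ((hsmul w).const_add v)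

lemma Matrix.hasFDerivAt_mulVec {𝕜 m n : Type*} [NontriviallyNormedField 𝕜] [CompleteSpace 𝕜]
    [Fintype m] [Fintype n] [DecidableEq n] (A : Matrix m n 𝕜) (x : n → 𝕜) :
    HasFDerivAt (fun y => A *ᵥ y) (LinearMap.toContinuousLinearMap (toLin' A)) x :=
  (LinearMap.toContinuousLinearMap (toLin' A)).hasFDerivAt

/-- The divergence of `y ↦ M (g y • (B y + w))`, by the product rule. -/
lemma Matrix.trace_fderiv_mulVec_smul {𝕜 n : Type*} [NontriviallyNormedField 𝕜]
    [CompleteSpace 𝕜] [Fintype n] [DecidableEq n] (M B : Matrix n n 𝕜) (w : n → 𝕜)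
    {g : (n → 𝕜) → 𝕜} {g' : (n → 𝕜) →L[𝕜] 𝕜} {x : n → 𝕜} (hg : HasFDerivAt g g' x) :
    LinearMap.trace 𝕜 (n → 𝕜)
        (fderiv 𝕜 (fun y => M *ᵥ (g y • (B *ᵥ y + w))) x : (n → 𝕜) →ₗ[𝕜] (n → 𝕜)) =
      g x * (M * B).trace + g' (M *ᵥ (B *ᵥ x + w)) := by
  have hF : HasFDerivAt (fun y => M *ᵥ (g y • (B *ᵥ y + w))) _ x :=
    (M.hasFDerivAt_mulVec _).comp x (hg.smul ((B.hasFDerivAt_mulVec x).add_const w))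
  have hlin : (fderiv 𝕜 (fun y => M *ᵥ (g y • (B *ᵥ y + w))) x : (n → 𝕜) →ₗ[𝕜] (n → 𝕜)) =
      g x • toLin' (M * B) + (g' : (n → 𝕜) →ₗ[𝕜] 𝕜).smulRight (M *ᵥ (B *ᵥ x + w)) := by
    refine LinearMap.ext fun y => ?_
    rw [ContinuousLinearMap.coe_coe, hF.fderiv]
    simp [mulVec_add, mulVec_smul]
  rw [hlin, map_add, map_smul, trace_toLin'_eq, LinearMap.trace_smulRight]
  simp

/-- The ALE transport identity: for the affine ALE mapping `χ (ξ, t) = A(t) ξ + v(t)`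
with `A(t) = A₀ + t • B` invertible on the open interval `(a, b)`,
`v(t) = v₀ + t • w`, Jacobian determinant `J(t) = det A(t)`, grid velocity
`ω(ξ, t) = B ξ + w`, and a continuously differentiable `u`, one has
`J(t) ∂ₜu(χ(ξ,t), t) = ∂ₜ[J(t) u*(ξ,t)] − J(t) divₓ(ξ' ↦ A(t)⁻¹ (u*(ξ',t) • ω(ξ',t)))(ξ)`,
where `u*(ξ,t) = u(χ(ξ,t), t)` and the divergence is the trace of the Fréchet
derivative in `ξ`. -/
theorem ale_transport_identity
    (d : ℕ) (a b : ℝ) (A₀ B : Matrix (Fin d) (Fin d) ℝ) (v₀ w : Fin d → ℝ)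
    (hinv : ∀ t ∈ Set.Ioo a b, IsUnit (A₀ + t • B).det)
    (u : (Fin d → ℝ) → ℝ → ℝ)
    (hu : ContDiff ℝ 1 (fun p : (Fin d → ℝ) × ℝ => u p.1 p.2)) :
    ∀ (ξ : Fin d → ℝ), ∀ t ∈ Set.Ioo a b,
      (A₀ + t • B).det *
          deriv (fun s : ℝ => u ((A₀ + t • B).mulVec ξ + (v₀ + t • w)) s) t =
        deriv (fun s : ℝ =>
            (A₀ + s • B).det * u ((A₀ + s • B).mulVec ξ + (v₀ + s • w)) s) t -
          (A₀ + t • B).det *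
            LinearMap.trace ℝ (Fin d → ℝ)
              ((fderiv ℝ (fun ξ' : Fin d → ℝ =>
                  (A₀ + t • B)⁻¹.mulVec
                    (u ((A₀ + t • B).mulVec ξ' + (v₀ + t • w)) t •
                      (B.mulVec ξ' + w))) ξ) :
                (Fin d → ℝ) →ₗ[ℝ] (Fin d → ℝ)) := by
  intro ξ t ht
  have hM := hinv t ht
  set x := (A₀ + t • B) *ᵥ ξ + (v₀ + t • w) with hx
  obtain ⟨D, hD⟩ := hu.differentiable one_ne_zero (x, t)
  have hpartial : HasDerivAt (fun s => u x s) (D (0, 1)) t :=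
    hD.comp_hasDerivAt t ((hasDerivAt_const t x).prodMk (hasDerivAt_id t))
  have hmaterial : HasDerivAt (fun s => u ((A₀ + s • B) *ᵥ ξ + (v₀ + s • w)) s)
      (D (B *ᵥ ξ + w, 1)) t :=
    HasFDerivAt.comp_hasDerivAt (l := fun p : (Fin d → ℝ) × ℝ => u p.1 p.2)
      (f := fun s => ((A₀ + s • B) *ᵥ ξ + (v₀ + s • w), s)) t hD
      ((hasDerivAt_add_smul_mulVec_add A₀ B v₀ w ξ t).prodMk (hasDerivAt_id t))
  have hspace : HasFDerivAt (fun y => u ((A₀ + t • B) *ᵥ y + (v₀ + t • w)) t) _ ξ :=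
    HasFDerivAt.comp (g := fun p : (Fin d → ℝ) × ℝ => u p.1 p.2) ξ hD
      ((((A₀ + t • B).hasFDerivAt_mulVec ξ).add_const _).prodMk (hasFDerivAt_const t ξ))
  have hsplit : D (B *ᵥ ξ + w, 1) = D (B *ᵥ ξ + w, 0) + D (0, 1) := by
    rw [← map_add]
    simp
  rw [hpartial.deriv, ((hasDerivAt_det_add_smul A₀ B t hM).fun_mul hmaterial).deriv,
    trace_fderiv_mulVec_smul _ B w hspace, hsplit]
  simp only [ContinuousLinearMap.comp_apply, ContinuousLinearMap.prod_apply,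
    LinearMap.coe_toContinuousLinearMap', toLin'_apply, mulVec_mulVec,
    mul_nonsing_inv _ hM, one_mulVec, _root_.zero_apply, ← hx]
  ring
end

section
/- Let g : ℝ → ℝ and ĝ : ℝ × ℝ → ℝ satisfy: ĝ(u, u) = g(u) for all u (consistency), u ↦ ĝ(u, v) is monotone nondecreasing for each fixed v, and v ↦ ĝ(u, v) is monotone nonincreasing for each fixed u. Then for all u₁, u₂ ∈ ℝ and every v with min(u₁, u₂) ≤ v ≤ max(u₁, u₂), one has (g(v) − ĝ(u₁, u₂)) · (u₂ − u₁) ≥ 0. -/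
/-- Osher's e-flux condition: a consistent numerical flux that is nondecreasing in its
first argument and nonincreasing in its second argument satisfies
`(g(v) − ĝ(u₁, u₂)) (u₂ − u₁) ≥ 0` for every `v` between `u₁` and `u₂`. -/
theorem monotone_flux_eflux
    (g : ℝ → ℝ) (ghat : ℝ → ℝ → ℝ)
    (hcons : ∀ u : ℝ, ghat u u = g u)
    (hmono : ∀ v : ℝ, Monotone fun u => ghat u v)
    (hanti : ∀ u : ℝ, Antitone fun v => ghat u v) :
    ∀ u₁ u₂ v : ℝ, min u₁ u₂ ≤ v → v ≤ max u₁ u₂ →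
      0 ≤ (g v - ghat u₁ u₂) * (u₂ - u₁) := by
  intro u₁ u₂ v hmin hmax
  rw [← hcons v]
  rcases le_total u₁ u₂ with h | h
  · rw [min_eq_left h] at hmin
    rw [max_eq_right h] at hmax
    have hflux : ghat u₁ u₂ ≤ ghat v v := (hmono u₂ hmin).trans (hanti v hmax)
    exact mul_nonneg (sub_nonneg.2 hflux) (sub_nonneg.2 h)
  · rw [min_eq_right h] at hmin
    rw [max_eq_left h] at hmax
    have hflux : ghat v v ≤ ghat u₁ u₂ := (hanti v hmin).trans (hmono u₂ hmax)
    exact mul_nonneg_of_nonpos_of_nonpos (sub_nonpos.2 hflux) (sub_nonpos.2 h)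
end

section
/- Let g : ℝ → ℝ and ĝ : ℝ × ℝ → ℝ satisfy: ĝ(u, u) = g(u) for all u (consistency), u ↦ ĝ(u, v) is monotone nondecreasing for each fixed v, and v ↦ ĝ(u, v) is monotone nonincreasing for each fixed u. Let G : ℝ → ℝ be differentiable with G' = g. Then for all u₁, u₂ ∈ ℝ: G(u₂) − G(u₁) − ĝ(u₁, u₂)·(u₂ − u₁) ≥ 0. -/
/-- The interface dissipation estimate in the `L²`-stability proof: for a consistent
monotone numerical flux `ĝ` and an antiderivative `G` of the physical flux `g`,
`G(u₂) − G(u₁) − ĝ(u₁, u₂) (u₂ − u₁) ≥ 0`. -/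
theorem monotone_flux_entropy_dissipation
    (g : ℝ → ℝ) (ghat : ℝ → ℝ → ℝ) (G : ℝ → ℝ)
    (hcons : ∀ u : ℝ, ghat u u = g u)
    (hmono : ∀ v : ℝ, Monotone fun u => ghat u v)
    (hanti : ∀ u : ℝ, Antitone fun v => ghat u v)
    (hG : ∀ u : ℝ, HasDerivAt G (g u) u) :
    ∀ u₁ u₂ : ℝ, 0 ≤ G u₂ - G u₁ - ghat u₁ u₂ * (u₂ - u₁) := by
  have mvt : ∀ a b : ℝ, a < b → ∃ c ∈ Set.Ioo a b, G b - G a = g c * (b - a) := by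
    intro a b hab
    obtain ⟨c, hc, h⟩ := exists_hasDerivAt_eq_slope G g hab
      (fun x _ => (hG x).continuousAt.continuousWithinAt) (fun x _ => hG x)
    exact ⟨c, hc, by rw [h, div_mul_cancel₀ _ (sub_pos.2 hab).ne']⟩
  intro u₁ u₂
  rcases lt_trichotomy u₁ u₂ with h | rfl | h
  · obtain ⟨c, ⟨h₁, h₂⟩, hc⟩ := mvt u₁ u₂ h
    have hg : ghat u₁ u₂ ≤ g c :=
      hcons c ▸ (hanti u₁ h₂.le).trans (hmono c h₁.le)
    rw [hc, ← sub_mul]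
    exact mul_nonneg (sub_nonneg.2 hg) (sub_nonneg.2 h.le)
  · simp
  · obtain ⟨c, ⟨h₂, h₁⟩, hc⟩ := mvt u₂ u₁ h
    have hg : g c ≤ ghat u₁ u₂ :=
      hcons c ▸ (hmono c h₁.le).trans (hanti u₁ h₂.le)
    have hprod := mul_nonneg (sub_nonneg.2 hg) (sub_nonneg.2 h.le)
    linarith
end

section
/- Let m ≤ M, let g : ℝ → ℝ be differentiable on [m, M] with |g'(u)| ≤ λ for all u ∈ [m, M], and define the Lax–Friedrichs numerical flux ĝ(u₁, u₂) := (λ(u₁ − u₂) + g(u₁) + g(u₂))/2. Let μ ≥ 0 and α ∈ ℝ with α + μλ ≤ 1. Define H₁(b₁, b₂, c₁) := (1 − α) b₁ − μ ĝ(b₁, c₁) + μ ĝ(b₂, b₁). Then H₁ is monotone nondecreasing in each of its three arguments on [m, M]³; that is, for arguments in [m, M], increasing any one of b₁, b₂, c₁ (keeping the others fixed) does not decrease H₁. -/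
/-- The one-edge building block `H₁(b₁,b₂,c₁) = (1−α)b₁ − μĝ(b₁,c₁) + μĝ(b₂,b₁)` of
the TVD-RK ALE-DG cell-average scheme, with the Lax–Friedrichs flux
`ĝ(u₁,u₂) = (λ(u₁−u₂) + g(u₁) + g(u₂))/2`, is monotone nondecreasing in each of its
three arguments on `[m, M]³` under the CFL constraint `α + μλ ≤ 1`. -/
theorem ale_dg_edge_update_H1_monotone
    (m M lam : ℝ) (hmM : m ≤ M) (g : ℝ → ℝ)
    (hg : DifferentiableOn ℝ g (Set.Icc m M))
    (hbound : ∀ u ∈ Set.Icc m M, |derivWithin g (Set.Icc m M) u| ≤ lam)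
    (ghat : ℝ → ℝ → ℝ)
    (hghat : ∀ u₁ u₂ : ℝ, ghat u₁ u₂ = (lam * (u₁ - u₂) + g u₁ + g u₂) / 2)
    (μ α : ℝ) (hμ : 0 ≤ μ) (hCFL : α + μ * lam ≤ 1)
    (H₁ : ℝ → ℝ → ℝ → ℝ)
    (hH₁ : ∀ b₁ b₂ c₁ : ℝ,
      H₁ b₁ b₂ c₁ = (1 - α) * b₁ - μ * ghat b₁ c₁ + μ * ghat b₂ b₁) :
    (∀ b₂ ∈ Set.Icc m M, ∀ c₁ ∈ Set.Icc m M,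
        MonotoneOn (fun b₁ => H₁ b₁ b₂ c₁) (Set.Icc m M)) ∧
    (∀ b₁ ∈ Set.Icc m M, ∀ c₁ ∈ Set.Icc m M,
        MonotoneOn (fun b₂ => H₁ b₁ b₂ c₁) (Set.Icc m M)) ∧
    (∀ b₁ ∈ Set.Icc m M, ∀ b₂ ∈ Set.Icc m M,
        MonotoneOn (fun c₁ => H₁ b₁ b₂ c₁) (Set.Icc m M)) := by
  have lip : ∀ x ∈ Set.Icc m M, ∀ y ∈ Set.Icc m M, x ≤ y → |g y - g x| ≤ lam * (y - x) := by
    intro x hx y hy hxy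
    have h := (convex_Icc m M).norm_image_sub_le_of_norm_derivWithin_le hg hbound hx hy
    rwa [Real.norm_eq_abs, Real.norm_eq_abs, abs_of_nonneg (sub_nonneg.2 hxy)] at h
  refine ⟨fun b₂ _ c₁ _ x _ y _ hxy => ?_, fun b₁ _ c₁ _ x hx y hy hxy => ?_,
    fun b₁ _ b₂ _ x hx y hy hxy => ?_⟩ <;> simp only [hH₁, hghat]
  · linear_combination mul_nonneg (sub_nonneg.2 hCFL) (sub_nonneg.2 hxy)
  · have h := neg_le_of_abs_le (lip x hx y hy hxy)
    linear_combination μ / 2 * h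
  · have h := le_of_abs_le (lip x hx y hy hxy)
    linear_combination μ / 2 * h
end

section
/- Let m ≤ M, let g₁, g₂, g₃ : ℝ → ℝ each be differentiable on [m, M] with |g_ν'(u)| ≤ λ for all u ∈ [m, M] and ν = 1, 2, 3, and define the Lax–Friedrichs numerical fluxes ĝ_ν(u₁, u₂) := (λ(u₁ − u₂) + g_ν(u₁) + g_ν(u₂))/2. Let μ₁, μ₂, μ₃ ≥ 0 and α ∈ ℝ with α + (μ₁ + μ₂ + μ₃)λ ≤ 1. Define H₂(b₁, b₂, b₃, c₂) := (1 − α) b₂ − μ₁ ĝ₁(b₂, b₁) − μ₂ ĝ₂(b₂, c₂) − μ₃ ĝ₃(b₂, b₃). Then H₂ is monotone nondecreasing in each of its four arguments on [m, M]⁴. -/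
/-- Mean value inequality on an interval, for ordered endpoints. -/
theorem abs_sub_le_of_abs_derivWithin_Icc_le {m M L : ℝ} {g : ℝ → ℝ}
    (hg : DifferentiableOn ℝ g (Set.Icc m M))
    (hbound : ∀ u ∈ Set.Icc m M, |derivWithin g (Set.Icc m M) u| ≤ L)
    {x y : ℝ} (hx : x ∈ Set.Icc m M) (hy : y ∈ Set.Icc m M) (hxy : x ≤ y) :
    |g y - g x| ≤ L * (y - x) := by
  have h := (convex_Icc m M).norm_image_sub_le_of_norm_derivWithin_le hg hbound hx hy
  rwa [Real.norm_eq_abs, Real.norm_eq_abs, abs_of_nonneg (sub_nonneg.2 hxy)] at h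

/-- Weighted upper bound on the increment of a function with bounded derivative. -/
theorem mul_sub_le_of_abs_derivWithin_Icc_le {m M L μ : ℝ} {g : ℝ → ℝ}
    (hg : DifferentiableOn ℝ g (Set.Icc m M))
    (hbound : ∀ u ∈ Set.Icc m M, |derivWithin g (Set.Icc m M) u| ≤ L) (hμ : 0 ≤ μ)
    {x y : ℝ} (hx : x ∈ Set.Icc m M) (hy : y ∈ Set.Icc m M) (hxy : x ≤ y) :
    μ * (g y - g x) ≤ μ * (L * (y - x)) :=
  mul_le_mul_of_nonneg_left
    (abs_le.1 (abs_sub_le_of_abs_derivWithin_Icc_le hg hbound hx hy hxy)).2 hμ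

/-- The three-edge building block
`H₂(b₁,b₂,b₃,c₂) = (1−α)b₂ − μ₁ĝ₁(b₂,b₁) − μ₂ĝ₂(b₂,c₂) − μ₃ĝ₃(b₂,b₃)` of the
TVD-RK ALE-DG cell-average scheme, with Lax–Friedrichs fluxes
`ĝ_ν(u₁,u₂) = (λ(u₁−u₂) + g_ν(u₁) + g_ν(u₂))/2`, is monotone nondecreasing in each
of its four arguments on `[m, M]⁴` under the CFL constraint
`α + (μ₁ + μ₂ + μ₃)λ ≤ 1`. -/
theorem ale_dg_edge_update_H2_monotone
    (m M lam : ℝ) (hmM : m ≤ M) (g₁ g₂ g₃ : ℝ → ℝ)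
    (hg₁ : DifferentiableOn ℝ g₁ (Set.Icc m M))
    (hg₂ : DifferentiableOn ℝ g₂ (Set.Icc m M))
    (hg₃ : DifferentiableOn ℝ g₃ (Set.Icc m M))
    (hbound₁ : ∀ u ∈ Set.Icc m M, |derivWithin g₁ (Set.Icc m M) u| ≤ lam)
    (hbound₂ : ∀ u ∈ Set.Icc m M, |derivWithin g₂ (Set.Icc m M) u| ≤ lam)
    (hbound₃ : ∀ u ∈ Set.Icc m M, |derivWithin g₃ (Set.Icc m M) u| ≤ lam)
    (ghat₁ ghat₂ ghat₃ : ℝ → ℝ → ℝ)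
    (hghat₁ : ∀ u₁ u₂ : ℝ, ghat₁ u₁ u₂ = (lam * (u₁ - u₂) + g₁ u₁ + g₁ u₂) / 2)
    (hghat₂ : ∀ u₁ u₂ : ℝ, ghat₂ u₁ u₂ = (lam * (u₁ - u₂) + g₂ u₁ + g₂ u₂) / 2)
    (hghat₃ : ∀ u₁ u₂ : ℝ, ghat₃ u₁ u₂ = (lam * (u₁ - u₂) + g₃ u₁ + g₃ u₂) / 2)
    (μ₁ μ₂ μ₃ α : ℝ) (hμ₁ : 0 ≤ μ₁) (hμ₂ : 0 ≤ μ₂) (hμ₃ : 0 ≤ μ₃)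
    (hCFL : α + (μ₁ + μ₂ + μ₃) * lam ≤ 1)
    (H₂ : ℝ → ℝ → ℝ → ℝ → ℝ)
    (hH₂ : ∀ b₁ b₂ b₃ c₂ : ℝ,
      H₂ b₁ b₂ b₃ c₂ = (1 - α) * b₂ - μ₁ * ghat₁ b₂ b₁ - μ₂ * ghat₂ b₂ c₂
        - μ₃ * ghat₃ b₂ b₃) :
    (∀ b₂ ∈ Set.Icc m M, ∀ b₃ ∈ Set.Icc m M, ∀ c₂ ∈ Set.Icc m M,
        MonotoneOn (fun b₁ => H₂ b₁ b₂ b₃ c₂) (Set.Icc m M)) ∧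
    (∀ b₁ ∈ Set.Icc m M, ∀ b₃ ∈ Set.Icc m M, ∀ c₂ ∈ Set.Icc m M,
        MonotoneOn (fun b₂ => H₂ b₁ b₂ b₃ c₂) (Set.Icc m M)) ∧
    (∀ b₁ ∈ Set.Icc m M, ∀ b₂ ∈ Set.Icc m M, ∀ c₂ ∈ Set.Icc m M,
        MonotoneOn (fun b₃ => H₂ b₁ b₂ b₃ c₂) (Set.Icc m M)) ∧
    (∀ b₁ ∈ Set.Icc m M, ∀ b₂ ∈ Set.Icc m M, ∀ b₃ ∈ Set.Icc m M,
        MonotoneOn (fun c₂ => H₂ b₁ b₂ b₃ c₂) (Set.Icc m M)) := by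
  simp only [hH₂, hghat₁, hghat₂, hghat₃]
  refine ⟨fun b₂ _ b₃ _ c₂ _ x hx y hy hxy => ?_, fun b₁ _ b₃ _ c₂ _ x hx y hy hxy => ?_,
    fun b₁ _ b₂ _ c₂ _ x hx y hy hxy => ?_, fun b₁ _ b₂ _ b₃ _ x hx y hy hxy => ?_⟩ <;>
    dsimp only
  · linarith [mul_sub_le_of_abs_derivWithin_Icc_le hg₁ hbound₁ hμ₁ hx hy hxy]
  · linarith [mul_sub_le_of_abs_derivWithin_Icc_le hg₁ hbound₁ hμ₁ hx hy hxy,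
      mul_sub_le_of_abs_derivWithin_Icc_le hg₂ hbound₂ hμ₂ hx hy hxy,
      mul_sub_le_of_abs_derivWithin_Icc_le hg₃ hbound₃ hμ₃ hx hy hxy,
      mul_le_mul_of_nonneg_right hCFL (sub_nonneg.2 hxy)]
  · linarith [mul_sub_le_of_abs_derivWithin_Icc_le hg₃ hbound₃ hμ₃ hx hy hxy]
  · linarith [mul_sub_le_of_abs_derivWithin_Icc_le hg₂ hbound₂ hμ₂ hx hy hxy]
end

section
/- Let m ≤ M and let ū, m_K, M_K ∈ ℝ satisfy m_K ≤ ū ≤ M_K and m ≤ ū ≤ M. Define θ := min{ |M − ū| / |M_K − ū| , |m − ū| / |m_K − ū| , 1 } (with real division, taking x/0 = 0). Then for every value p with m_K ≤ p ≤ M_K, the limited value ũ := θ·(p − ū) + ū satisfies m ≤ ũ ≤ M. -/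
/-- Bound-preserving property of the Zhang–Xia–Shu scaling limiter: with cell average
`ū ∈ [m, M]`, cell extrema `m_K ≤ ū ≤ M_K`, and scaling factor
`θ = min(|M − ū|/|M_K − ū|, |m − ū|/|m_K − ū|, 1)` (real division, `x/0 = 0`),
every value `p ∈ [m_K, M_K]` is mapped by `p ↦ θ(p − ū) + ū` into `[m, M]`. -/
theorem zhang_xia_shu_limiter_bound_preserving
    (m M ubar mK MK : ℝ) (hmM : m ≤ M)
    (h₁ : mK ≤ ubar) (h₂ : ubar ≤ MK) (h₃ : m ≤ ubar) (h₄ : ubar ≤ M) :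
    ∀ p : ℝ, mK ≤ p → p ≤ MK →
      m ≤ min (min (|M - ubar| / |MK - ubar|) (|m - ubar| / |mK - ubar|)) 1
            * (p - ubar) + ubar ∧
      min (min (|M - ubar| / |MK - ubar|) (|m - ubar| / |mK - ubar|)) 1
            * (p - ubar) + ubar ≤ M := by
  intro p hp₁ hp₂
  set θ := min (min (|M - ubar| / |MK - ubar|) (|m - ubar| / |mK - ubar|)) 1
  have hθ : 0 ≤ θ := by positivity
  have hθM : θ ≤ |M - ubar| / |MK - ubar| := (min_le_left _ _).trans (min_le_left _ _)
  have hθm : θ ≤ |m - ubar| / |mK - ubar| := (min_le_left _ _).trans (min_le_right _ _)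
  have hM := mul_le_of_le_div₀ (abs_nonneg _) (abs_nonneg _) hθM
  have hm := mul_le_of_le_div₀ (abs_nonneg _) (abs_nonneg _) hθm
  rw [abs_of_nonneg (sub_nonneg.2 h₂), abs_of_nonneg (sub_nonneg.2 h₄)] at hM
  rw [abs_of_nonpos (sub_nonpos.2 h₁), abs_of_nonpos (sub_nonpos.2 h₃)] at hm
  have hlower := mul_le_mul_of_nonneg_left (sub_le_sub_right hp₁ ubar) hθ
  have hupper := mul_le_mul_of_nonneg_left (sub_le_sub_right hp₂ ubar) hθ
  constructor <;> linarith
end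

section
/- Let J : ℝ → ℝ be a polynomial function of degree at most 3, and let t_n, Δt ∈ ℝ. Define the TVD-RK3 stages y₁ := J(t_n) + Δt·J'(t_n), y₂ := (3/4)J(t_n) + (1/4)y₁ + (1/4)Δt·J'(t_n + Δt), and y₃ := (1/3)J(t_n) + (2/3)y₂ + (2/3)Δt·J'(t_n + Δt/2). Then y₃ = J(t_n + Δt). -/
/-- Exactness of the third order TVD-RK method for polynomials of degree at most 3:
with stages `y₁ = J(tₙ) + Δt J'(tₙ)`, `y₂ = ¾J(tₙ) + ¼y₁ + ¼Δt J'(tₙ + Δt)` and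
`y₃ = ⅓J(tₙ) + ⅔y₂ + ⅔Δt J'(tₙ + Δt/2)`, one has `y₃ = J(tₙ + Δt)`.
This underlies the discrete geometric conservation law of the TVD-RK3 ALE-DG
method in up to three space dimensions. -/
theorem tvd_rk3_exact_on_cubics
    (p : Polynomial ℝ) (hp : p.natDegree ≤ 3) (tn Δt : ℝ) :
    (1 / 3) * p.eval tn
      + (2 / 3) * ((3 / 4) * p.eval tn
          + (1 / 4) * (p.eval tn + Δt * p.derivative.eval tn)
          + (1 / 4) * Δt * p.derivative.eval (tn + Δt))
      + (2 / 3) * Δt * p.derivative.eval (tn + Δt / 2) = p.eval (tn + Δt) := by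
  rw [p.as_sum_range_C_mul_X_pow' (Nat.lt_succ_of_le hp)]
  simp only [Nat.succ_eq_add_one, Finset.sum_range_succ, Finset.sum_range_zero,
    Polynomial.derivative_add, Polynomial.derivative_C_mul_X_pow, Polynomial.derivative_zero,
    Polynomial.eval_add, Polynomial.eval_mul, Polynomial.eval_C, Polynomial.eval_pow,
    Polynomial.eval_X, Polynomial.eval_zero]
  push_cast
  ring
end
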